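/- arXiv:1805.03186 — 8 statements merged into one kernel-verified Lean document; each statement's English description precedes it below -/
import Mathlib

section
/- The density of integer lattice points visible from the origin is 6/π²; precisely, the limit as N → ∞ of (1/N²)·#{(x,y) ∈ ℤ² : 1 ≤ x ≤ N, 1 ≤ y ≤ N, gcd(x,y) = 1} equals 6/π². -/
open Filter

namespace VisiblePoints

open scoped ArithmeticFunction.Moebius LSeries.notation

/-- The Möbius function sums over the divisors of `n` to the indicator of `n = 1`. -/
lemma sum_divisors_moebius (n : ℕ) :
    ∑ d ∈ n.divisors, μ d = if n = 1 then 1 else 0 := by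
  rw [← ArithmeticFunction.coe_mul_zeta_apply, ArithmeticFunction.moebius_mul_coe_zeta,
    ArithmeticFunction.one_apply]

/-- The number of pairs in `[1, N]²` with both coordinates divisible by `d` is `⌊N / d⌋²`. -/
lemma card_filter_dvd_dvd (N d : ℕ) :
    ((Finset.Icc 1 N ×ˢ Finset.Icc 1 N).filter (fun p : ℕ × ℕ => d ∣ p.1 ∧ d ∣ p.2)).card =
      (N / d) ^ 2 := by
  rw [Finset.filter_product (fun x => d ∣ x) (fun x => d ∣ x), Finset.card_product,
    show Finset.Icc 1 N = Finset.Ioc 0 N from rfl, Nat.Ioc_filter_dvd_card_eq_div, sq]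

lemma card_visible_eq_sum (N : ℕ) :
    (((Finset.Icc 1 N ×ˢ Finset.Icc 1 N).filter
      (fun p : ℕ × ℕ => Nat.gcd p.1 p.2 = 1)).card : ℤ) =
      ∑ d ∈ Finset.Icc 1 N, μ d * ((N / d : ℕ) : ℤ) ^ 2 := by
  have key : ∀ p ∈ Finset.Icc 1 N ×ˢ Finset.Icc 1 N,
      (if Nat.gcd p.1 p.2 = 1 then (1 : ℤ) else 0) =
        ∑ d ∈ Finset.Icc 1 N, if d ∣ p.1 ∧ d ∣ p.2 then μ d else 0 := by
    rintro ⟨x, y⟩ hp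
    simp only [Finset.mem_product, Finset.mem_Icc] at hp
    rw [← sum_divisors_moebius, ← Finset.sum_filter]
    refine Finset.sum_congr ?_ fun _ _ => rfl
    ext d
    simp only [Nat.mem_divisors, Finset.mem_filter, Finset.mem_Icc, Nat.dvd_gcd_iff]
    refine ⟨fun h => ⟨⟨Nat.pos_of_dvd_of_pos h.1.1 (by omega),
      (Nat.le_of_dvd (by omega) h.1.1).trans hp.1.2⟩, h.1⟩, fun h => ⟨h.2, ?_⟩⟩
    exact (Nat.gcd_pos_of_pos_left _ (by omega)).ne'
  rw [Finset.natCast_card_filter, Finset.sum_congr rfl key, Finset.sum_comm]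
  refine Finset.sum_congr rfl fun d _ => ?_
  rw [← Finset.sum_filter, Finset.sum_const, card_filter_dvd_dvd, nsmul_eq_mul, mul_comm]
  push_cast
  rfl

lemma card_visible_div_sq_eq_tsum (N : ℕ) :
    (((Finset.Icc 1 N ×ˢ Finset.Icc 1 N).filter
      (fun p : ℕ × ℕ => Nat.gcd p.1 p.2 = 1)).card : ℝ) / (N : ℝ) ^ 2 =
      ∑' d : ℕ, (μ d : ℝ) * (((N / d : ℕ) : ℝ) / N) ^ 2 := by
  rw [tsum_eq_sum (s := Finset.Icc 1 N)]
  · have h := congrArg (Int.cast : ℤ → ℝ) (card_visible_eq_sum N)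
    rw [Int.cast_natCast, Int.cast_sum] at h
    rw [h, Finset.sum_div]
    refine Finset.sum_congr rfl fun d _ => ?_
    rw [Int.cast_mul, Int.cast_pow, Int.cast_natCast, div_pow, mul_div_assoc]
  · intro d hd
    have : N / d = 0 := by
      rw [Finset.mem_Icc] at hd
      rcases Nat.eq_zero_or_pos d with rfl | h
      · simp
      · exact Nat.div_eq_of_lt (by omega)
    simp [this]

lemma tendsto_nat_div_div (d : ℕ) :
    Tendsto (fun N : ℕ => ((N / d : ℕ) : ℝ) / N) atTop (nhds (1 / (d : ℝ))) := by
  have h := (tendsto_nat_floor_mul_div_atTop (R := ℝ) (a := 1 / (d : ℝ)) (by positivity)).comp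
    tendsto_natCast_atTop_atTop
  refine h.congr fun N => ?_
  simp only [Function.comp_apply]
  rw [one_div_mul_eq_div, Nat.floor_div_eq_div]

lemma tsum_moebius_div_sq :
    ∑' d : ℕ, (μ d : ℝ) * (1 / (d : ℝ)) ^ 2 = 6 / Real.pi ^ 2 := by
  have h : riemannZeta 2 * LSeries ↗μ 2 = 1 := by
    rw [← LSeries_one_eq_riemannZeta (by norm_num)]
    exact LSeries_one_mul_Lseries_moebius (by norm_num)
  have hL : LSeries ↗μ 2 = ((∑' d : ℕ, (μ d : ℝ) * (1 / (d : ℝ)) ^ 2 : ℝ) : ℂ) := by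
    rw [LSeries, Complex.ofReal_tsum]
    refine tsum_congr fun d => ?_
    rcases eq_or_ne d 0 with rfl | hd
    · simp
    · rw [LSeries.term_of_ne_zero hd, Complex.cpow_ofNat]
      push_cast
      ring
  rw [riemannZeta_two, hL] at h
  norm_cast at h
  have := Real.pi_ne_zero
  rw [eq_div_iff (by positivity)]
  linarith

lemma norm_moebius_mul_sq_le (N d : ℕ) :
    ‖(μ d : ℝ) * (((N / d : ℕ) : ℝ) / N) ^ 2‖ ≤ 1 / (d : ℝ) ^ 2 := by
  have hμ : |(μ d : ℝ)| ≤ 1 := by exact_mod_cast ArithmeticFunction.abs_moebius_le_one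
  have hq : ((N / d : ℕ) : ℝ) / N ≤ 1 / d := by
    rcases Nat.eq_zero_or_pos N with rfl | hN
    · simp
    · rw [div_le_iff₀ (by positivity), one_div_mul_eq_div]
      exact Nat.cast_div_le
  rw [norm_mul, Real.norm_eq_abs, Real.norm_of_nonneg (by positivity), ← one_div_pow]
  calc |(μ d : ℝ)| * (((N / d : ℕ) : ℝ) / N) ^ 2 ≤ 1 * (1 / (d : ℝ)) ^ 2 := by gcongr
    _ = _ := one_mul _

end VisiblePoints

/-- The density of integer lattice points visible from the origin is `6 / π²`:
the proportion of points `(x, y)` with `1 ≤ x, y ≤ N` and `gcd x y = 1` tends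
to `6 / π²` as `N → ∞`. -/
theorem density_visible_points :
    Tendsto
      (fun N : ℕ =>
        (((Finset.Icc 1 N ×ˢ Finset.Icc 1 N).filter
            (fun p : ℕ × ℕ => Nat.gcd p.1 p.2 = 1)).card : ℝ) / (N : ℝ) ^ 2)
      atTop (nhds (6 / Real.pi ^ 2)) := by
  simp_rw [VisiblePoints.card_visible_div_sq_eq_tsum]
  rw [← VisiblePoints.tsum_moebius_div_sq]
  exact tendsto_tsum_of_dominated_convergence hasSum_zeta_two.summable
    (fun d => ((VisiblePoints.tendsto_nat_div_div d).pow 2).const_mul _)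
    (Eventually.of_forall fun N d => VisiblePoints.norm_moebius_mul_sq_le N d)
end

section
/- For every natural number n ≥ 1, there exist two sets of n consecutive natural numbers X = {x₀+1, x₀+2, …, x₀+n} and Y = {y₀+1, y₀+2, …, y₀+n} such that X and Y are disjoint and gcd(x₀+i, y₀+j) > 1 for all 1 ≤ i, j ≤ n. -/
/-- For pairwise coprime positive moduli, there are arbitrarily large `x` such that every shift
`x + f i` is divisible by the corresponding modulus `s i`. -/
theorem exists_ge_forall_dvd_add {ι : Type*} (t : Finset ι) (s f : ι → ℕ)
    (hs : ∀ i ∈ t, s i ≠ 0) (hco : Set.Pairwise (t : Set ι) (Function.onFun Nat.Coprime s))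
    (N : ℕ) : ∃ x, N ≤ x ∧ ∀ i ∈ t, s i ∣ x + f i := by
  obtain ⟨x, hx⟩ := Nat.chineseRemainderOfFinset (fun i => f i * (s i - 1)) s t hs hco
  have hpos : 0 < ∏ i ∈ t, s i := Finset.prod_pos fun i hi => Nat.pos_of_ne_zero (hs i hi)
  refine ⟨x + (∏ i ∈ t, s i) * N, by nlinarith, fun i hi => ?_⟩
  have hdvd : s i ∣ x + f i := by
    refine (((hx i hi).add_right (f i)).dvd_iff dvd_rfl).2 ⟨f i, ?_⟩
    obtain ⟨k, hk⟩ := Nat.exists_eq_succ_of_ne_zero (hs i hi)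
    rw [hk, Nat.succ_sub_one, Nat.succ_eq_add_one]
    ring
  rw [add_right_comm]
  exact dvd_add hdvd (dvd_mul_of_dvd_left (Finset.dvd_prod_of_mem s hi) N)

/-- For every `n ≥ 1` there exist two disjoint sets of `n` consecutive natural
numbers `{x₀+1, …, x₀+n}` and `{y₀+1, …, y₀+n}` such that
`gcd (x₀+i) (y₀+j) > 1` for all `1 ≤ i, j ≤ n`. -/
theorem exists_consecutive_sets_gcd_gt_one (n : ℕ) (hn : 1 ≤ n) :
    ∃ x₀ y₀ : ℕ,
      Disjoint (Finset.Icc (x₀ + 1) (x₀ + n)) (Finset.Icc (y₀ + 1) (y₀ + n)) ∧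
      ∀ i j : ℕ, 1 ≤ i → i ≤ n → 1 ≤ j → j ≤ n →
        1 < Nat.gcd (x₀ + i) (y₀ + j) := by
  let p : ℕ × ℕ → ℕ := fun q => Nat.nth Nat.Prime (Nat.pair q.1 q.2)
  have hp (q : ℕ × ℕ) : (p q).Prime := Nat.prime_nth_prime _
  have hinj : Function.Injective p :=
    (Nat.nth_injective Nat.infinite_setOfPred_prime).comp Nat.pairEquiv.injective
  let t := Finset.Icc 1 n ×ˢ Finset.Icc 1 n
  have hco : Set.Pairwise (t : Set (ℕ × ℕ)) (Function.onFun Nat.Coprime p) :=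
    fun a _ b _ hab => (Nat.coprime_primes (hp a) (hp b)).2 (hinj.ne hab)
  obtain ⟨x, -, hx⟩ :=
    exists_ge_forall_dvd_add t p Prod.fst (fun q _ => (hp q).ne_zero) hco 0
  obtain ⟨y, hxy, hy⟩ :=
    exists_ge_forall_dvd_add t p Prod.snd (fun q _ => (hp q).ne_zero) hco (x + n)
  refine ⟨x, y, ?_, fun i j hi hin hj hjn => ?_⟩
  · rw [Finset.disjoint_left]
    intro a ha hb
    rw [Finset.mem_Icc] at ha hb
    omega
  · have hmem : (i, j) ∈ t :=
      Finset.mk_mem_product (Finset.mem_Icc.2 ⟨hi, hin⟩) (Finset.mem_Icc.2 ⟨hj, hjn⟩)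
    exact (hp (i, j)).one_lt.trans_le
      (Nat.le_of_dvd (Nat.gcd_pos_of_pos_left _ (by omega))
        (Nat.dvd_gcd (hx _ hmem) (hy _ hmem)))
end

section
/- For every natural number n ≥ 1 there exists an n×n hidden forest; that is, there exist natural numbers x ≥ 1 and y ≥ 1 such that gcd(x+i, y+j) > 1 for all 0 ≤ i, j ≤ n−1. -/
/-- A shifted Chinese remainder theorem: for pairwise coprime positive moduli `s k`, some positive
`x` has `s k ∣ x + f k` for every `k` in a finite set. -/
theorem exists_pos_forall_dvd_add {ι : Type*} (t : Finset ι) (s f : ι → ℕ)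
    (hs : ∀ k ∈ t, s k ≠ 0) (hco : Set.Pairwise (t : Set ι) (Function.onFun Nat.Coprime s)) :
    ∃ x : ℕ, 1 ≤ x ∧ ∀ k ∈ t, s k ∣ x + f k := by
  obtain ⟨x, hx⟩ := Nat.chineseRemainderOfFinset (fun k => (s k - 1) * f k) s t hs hco
  have hprod : 1 ≤ ∏ k ∈ t, s k :=
    Nat.one_le_iff_ne_zero.2 (Finset.prod_ne_zero_iff.2 hs)
  refine ⟨x + ∏ k ∈ t, s k, by omega, fun k hk => ?_⟩
  have hdvd : s k ∣ x + f k := by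
    rw [((hx k hk).add_right (f k)).dvd_iff dvd_rfl]
    refine ⟨f k, ?_⟩
    rw [← Nat.succ_mul, Nat.succ_eq_add_one,
      Nat.sub_add_cancel (Nat.one_le_iff_ne_zero.2 (hs k hk))]
  rw [add_right_comm]
  exact dvd_add hdvd (Finset.dvd_prod_of_mem s hk)

/-- For every `n ≥ 1` there exists an `n × n` hidden forest: natural numbers
`x, y ≥ 1` with `gcd (x+i) (y+j) > 1` for all `0 ≤ i, j ≤ n - 1`. -/
theorem exists_hidden_forest (n : ℕ) (hn : 1 ≤ n) :
    ∃ x y : ℕ, 1 ≤ x ∧ 1 ≤ y ∧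
      ∀ i j : ℕ, i ≤ n - 1 → j ≤ n - 1 → 1 < Nat.gcd (x + i) (y + j) := by
  let p : ℕ × ℕ → ℕ := fun k => Nat.nth Nat.Prime (Nat.pair k.1 k.2)
  have hp : ∀ k, (p k).Prime := fun k => Nat.prime_nth_prime _
  have hinj : Function.Injective p :=
    (Nat.nth_injective Nat.infinite_setOfPred_prime).comp Nat.pairEquiv.injective
  let t := Finset.range n ×ˢ Finset.range n
  have hco : Set.Pairwise (t : Set (ℕ × ℕ)) (Function.onFun Nat.Coprime p) :=
    fun k _ l _ hkl => (Nat.coprime_primes (hp k) (hp l)).2 (hinj.ne hkl)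
  have hne : ∀ k ∈ t, p k ≠ 0 := fun k _ => (hp k).ne_zero
  obtain ⟨x, hx, hxd⟩ := exists_pos_forall_dvd_add t p Prod.fst hne hco
  obtain ⟨y, hy, hyd⟩ := exists_pos_forall_dvd_add t p Prod.snd hne hco
  refine ⟨x, y, hx, hy, fun i j hi hj => ?_⟩
  have hmem : (i, j) ∈ t :=
    Finset.mk_mem_product (Finset.mem_range.2 (by omega)) (Finset.mem_range.2 (by omega))
  exact (hp (i, j)).one_lt.trans_le <|
    Nat.le_of_dvd (Nat.gcd_pos_of_pos_left _ (by omega))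
      (Nat.dvd_gcd (hxd _ hmem) (hyd _ hmem))
end

section
/- The closest 2×2 hidden forest in the first quadrant has corner (14,20): the four points (14+i, 20+j) with 0 ≤ i, j ≤ 1 satisfy gcd(14+i, 20+j) > 1, and for any natural numbers a, b ≥ 1 with gcd(a+i, b+j) > 1 for all 0 ≤ i, j ≤ 1, one has a² + b² ≥ 14² + 20². -/
/-- The closest `2 × 2` hidden forest in the first quadrant has corner `(14, 20)`. -/
theorem closest_two_by_two_hidden_forest :
    (∀ i j : ℕ, i ≤ 1 → j ≤ 1 → 1 < Nat.gcd (14 + i) (20 + j)) ∧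
    ∀ a b : ℕ, 1 ≤ a → 1 ≤ b →
      (∀ i j : ℕ, i ≤ 1 → j ≤ 1 → 1 < Nat.gcd (a + i) (b + j)) →
      14 ^ 2 + 20 ^ 2 ≤ a ^ 2 + b ^ 2 := by
  refine ⟨fun i j hi hj => by interval_cases i <;> interval_cases j <;> decide, ?_⟩
  intro a b ha hb h
  by_contra! hlt
  have ha' : a < 25 := by nlinarith
  have hb' : b < 25 := by nlinarith
  have key : ∀ a < 25, ∀ b < 25,
      ¬ (1 ≤ a ∧ 1 ≤ b ∧ a ^ 2 + b ^ 2 < 14 ^ 2 + 20 ^ 2 ∧ 1 < Nat.gcd a b ∧ 1 < Nat.gcd a (b + 1) ∧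
        1 < Nat.gcd (a + 1) b ∧ 1 < Nat.gcd (a + 1) (b + 1)) := by
    decide +kernel
  exact key a ha' b hb'
    ⟨ha, hb, hlt, h 0 0 (by simp) (by simp), h 0 1 (by simp) le_rfl, h 1 0 le_rfl (by simp),
      h 1 1 le_rfl le_rfl⟩
end

section
/- The closest 3×3 hidden forest in the first quadrant (up to reflectional symmetry) has corner (1274,1308): the nine points (1274+i, 1308+j) with 0 ≤ i, j ≤ 2 satisfy gcd(1274+i, 1308+j) > 1, and for any natural numbers a, b ≥ 1 with gcd(a+i, b+j) > 1 for all 0 ≤ i, j ≤ 2, one has a² + b² ≥ 1274² + 1308². -/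
/-- The odd primes less than `122`. -/
def oddPrimesBelow122 : List ℕ :=
  [3, 5, 7, 11, 13, 17, 19, 23, 29, 31, 37, 41, 43, 47, 53, 59, 61, 67, 71, 73, 79, 83, 89, 97,
    101, 103, 107, 109, 113]

theorem mem_oddPrimesBelow122 {p : ℕ} (hp : p.Prime) (h2 : p ≠ 2) (hlt : p < 122) :
    p ∈ oddPrimesBelow122 := by
  have h : ∀ q < 122, q.Prime → q ≠ 2 → q ∈ oddPrimesBelow122 := by decide +kernel
  exact h p hlt hp h2

/-- `m` is even or divisible by at least three odd primes less than `122`. -/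
def evenOrThreePrimes (m : ℕ) : Bool :=
  m % 2 == 0 || Nat.ble 3 (oddPrimesBelow122.filter fun p => m % p == 0).length

/-- The possible coordinates of a corner of a `3 × 3` hidden forest, up to `1825`. -/
def cornerCandidates : List ℕ :=
  (List.range 1826).filter fun a =>
    evenOrThreePrimes a && evenOrThreePrimes (a + 1) && evenOrThreePrimes (a + 2)

theorem lt_of_mul_mul_dvd {p q r m : ℕ} (hm : 0 < m) (hlt : m < 1830) (h : p * q * r ∣ m)
    (hp : 3 ≤ p) (hq : 3 ≤ q) (hpq : p ≠ q) (hp4 : p ≠ 4) (hq4 : q ≠ 4) : r < 122 := by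
  have hle := Nat.le_of_dvd hm h
  have h15 : 15 ≤ p * q := by
    rcases Nat.lt_or_ge p 5 with hp5 | hp5
    · have : 5 ≤ q := by omega
      nlinarith
    · nlinarith
  nlinarith

/-- An odd number sharing a factor with each of three consecutive integers has three distinct
odd prime factors. -/
theorem evenOrThreePrimes_of_one_lt_gcd {m b : ℕ} (hm : 0 < m) (hlt : m < 1830)
    (h : ∀ j ≤ 2, 1 < Nat.gcd m (b + j)) : evenOrThreePrimes m = true := by
  rcases Nat.even_or_odd m with he | ho
  · simp [evenOrThreePrimes, Nat.even_iff.mp he]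
  obtain ⟨p, hp, hpg⟩ := Nat.exists_prime_and_dvd (h 0 (by omega)).ne'
  obtain ⟨q, hq, hqg⟩ := Nat.exists_prime_and_dvd (h 1 (by omega)).ne'
  obtain ⟨r, hr, hrg⟩ := Nat.exists_prime_and_dvd (h 2 (by omega)).ne'
  obtain ⟨hpm, hpb⟩ := Nat.dvd_gcd_iff.mp hpg
  obtain ⟨hqm, hqb⟩ := Nat.dvd_gcd_iff.mp hqg
  obtain ⟨hrm, hrb⟩ := Nat.dvd_gcd_iff.mp hrg
  have ne_two : ∀ s : ℕ, s ∣ m → s ≠ 2 := by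
    rintro s hs rfl
    exact Nat.not_even_iff_odd.mpr ho (even_iff_two_dvd.mpr hs)
  have ne_four : ∀ s : ℕ, s.Prime → s ≠ 4 := by
    rintro s hs rfl
    norm_num at hs
  have hp2 := ne_two p hpm
  have hq2 := ne_two q hqm
  have hr2 := ne_two r hrm
  have hpq : p ≠ q := by
    rintro rfl
    have := (Nat.dvd_add_right (b := b) (by simpa using hpb)).mp hqb
    exact hp.one_lt.ne' (Nat.dvd_one.mp this)
  have hqr : q ≠ r := by
    rintro rfl
    have := (Nat.dvd_add_right (b := b + 1) hqb).mp (show q ∣ b + 1 + 1 from hrb)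
    exact hq.one_lt.ne' (Nat.dvd_one.mp this)
  have hpr : p ≠ r := by
    rintro rfl
    have := (Nat.dvd_add_right (b := b) (by simpa using hpb)).mp hrb
    exact hp2 ((Nat.prime_dvd_prime_iff_eq hp Nat.prime_two).mp this)
  have h3 : ∀ s : ℕ, s.Prime → s ≠ 2 → 3 ≤ s := fun s hs hs2 => by
    have := hs.two_le
    omega
  have hpqr : p * q * r ∣ m :=
    Nat.Coprime.mul_dvd_of_dvd_of_dvd
      (Nat.Coprime.mul_left ((Nat.coprime_primes hp hr).mpr hpr)
        ((Nat.coprime_primes hq hr).mpr hqr))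
      (Nat.Coprime.mul_dvd_of_dvd_of_dvd ((Nat.coprime_primes hp hq).mpr hpq) hpm hqm) hrm
  have hplt : p < 122 := lt_of_mul_mul_dvd (p := q) (q := r) hm hlt
    (by rwa [show q * r * p = p * q * r by ring]) (h3 q hq hq2) (h3 r hr hr2) hqr
    (ne_four q hq) (ne_four r hr)
  have hqlt : q < 122 := lt_of_mul_mul_dvd (p := p) (q := r) hm hlt
    (by rwa [show p * r * q = p * q * r by ring]) (h3 p hp hp2) (h3 r hr hr2) hpr
    (ne_four p hp) (ne_four r hr)
  have hrlt : r < 122 := lt_of_mul_mul_dvd hm hlt hpqr (h3 p hp hp2) (h3 q hq hq2) hpq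
    (ne_four p hp) (ne_four q hq)
  have hsub : ({p, q, r} : Finset ℕ) ⊆
      (oddPrimesBelow122.filter fun p => m % p == 0).toFinset := by
    intro s hs
    simp only [Finset.mem_insert, Finset.mem_singleton] at hs
    rw [List.mem_toFinset, List.mem_filter, beq_iff_eq]
    rcases hs with rfl | rfl | rfl
    · exact ⟨mem_oddPrimesBelow122 hp hp2 hplt, Nat.mod_eq_zero_of_dvd hpm⟩
    · exact ⟨mem_oddPrimesBelow122 hq hq2 hqlt, Nat.mod_eq_zero_of_dvd hqm⟩
    · exact ⟨mem_oddPrimesBelow122 hr hr2 hrlt, Nat.mod_eq_zero_of_dvd hrm⟩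
  have hcard := (Finset.card_le_card hsub).trans (List.toFinset_card_le _)
  rw [Finset.card_eq_three.mpr ⟨p, q, r, hpq, hpr, hqr, rfl⟩] at hcard
  rw [evenOrThreePrimes, Bool.or_eq_true]
  exact Or.inr (Nat.ble_eq.mpr hcard)

theorem mem_cornerCandidates {a b : ℕ} (ha : 1 ≤ a) (hlt : a < 1826)
    (h : ∀ i j : ℕ, i ≤ 2 → j ≤ 2 → 1 < Nat.gcd (a + i) (b + j)) : a ∈ cornerCandidates := by
  have key : ∀ i ≤ 2, evenOrThreePrimes (a + i) = true := fun i hi =>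
    evenOrThreePrimes_of_one_lt_gcd (by omega) (by omega) fun j hj => h i j hi hj
  rw [cornerCandidates, List.mem_filter, List.mem_range, Bool.and_eq_true, Bool.and_eq_true]
  exact ⟨hlt, ⟨key 0 (by omega), key 1 (by omega)⟩, key 2 (by omega)⟩

/-- Every candidate pair that is too close to the origin has a visible point. -/
theorem cornerCandidates_check :
    (cornerCandidates.all fun a => cornerCandidates.all fun b =>
      Nat.ble (1274 ^ 2 + 1308 ^ 2) (a ^ 2 + b ^ 2) ||
        [0, 1, 2].any fun i => [0, 1, 2].any fun j => Nat.ble (Nat.gcd (a + i) (b + j)) 1) =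
      true := by
  decide +kernel

/-- The closest `3 × 3` hidden forest in the first quadrant has corner `(1274, 1308)`. -/
theorem closest_three_by_three_hidden_forest :
    (∀ i j : ℕ, i ≤ 2 → j ≤ 2 → 1 < Nat.gcd (1274 + i) (1308 + j)) ∧
    ∀ a b : ℕ, 1 ≤ a → 1 ≤ b →
      (∀ i j : ℕ, i ≤ 2 → j ≤ 2 → 1 < Nat.gcd (a + i) (b + j)) →
      1274 ^ 2 + 1308 ^ 2 ≤ a ^ 2 + b ^ 2 := by
  constructor
  · intro i j hi hj
    interval_cases i <;> interval_cases j <;> norm_num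
  intro a b ha hb h
  by_contra! hlt
  have ha' : a < 1826 := by nlinarith
  have hb' : b < 1826 := by nlinarith
  have hamem := mem_cornerCandidates ha ha' h
  have hbmem := mem_cornerCandidates hb hb' fun i j hi hj => by
    rw [Nat.gcd_comm]
    exact h j i hj hi
  have hab := List.all_eq_true.mp (List.all_eq_true.mp cornerCandidates_check a hamem) b hbmem
  rcases Bool.or_eq_true _ _ ▸ hab with hle | hany
  · exact absurd (Nat.ble_eq.mp hle) (not_le.mpr hlt)
  · obtain ⟨i, hi, hany⟩ := List.any_eq_true.mp hany
    obtain ⟨j, hj, hgcd⟩ := List.any_eq_true.mp hany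
    have hi2 : i ≤ 2 := by simp at hi; omega
    have hj2 : j ≤ 2 := by simp at hj; omega
    exact absurd (h i j hi2 hj2) (not_lt.mpr (Nat.ble_eq.mp hgcd))
end

section
/- Fix an integer b ≥ 1. The proportion of points (r,s) ∈ ℕ×ℕ that are b-visible is 1/ζ(b+1); precisely, the limit as N → ∞ of (1/N²)·#{(r,s) : 1 ≤ r ≤ N, 1 ≤ s ≤ N, ggcd_b(r,s) = 1} equals 1/ζ(b+1), where ζ is the Riemann zeta function. -/
open Filter

/-- The generalized greatest common divisor of `r` and `s` with respect to `b`: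
the largest `k` with `k ∣ r` and `k ^ b ∣ s`. -/
noncomputable def ggcd (b r s : ℕ) : ℕ := sSup {k : ℕ | k ∣ r ∧ k ^ b ∣ s}

open scoped ArithmeticFunction.Moebius

/-- The common divisors defining `ggcd` are exactly the divisors of `ggcd`. -/
theorem dvd_ggcd_iff {b r s : ℕ} (hr : 0 < r) (k : ℕ) :
    k ∣ ggcd b r s ↔ k ∣ r ∧ k ^ b ∣ s := by
  have hbdd : BddAbove {k : ℕ | k ∣ r ∧ k ^ b ∣ s} := ⟨r, fun _ hk => Nat.le_of_dvd hr hk.1⟩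
  have hmem : ggcd b r s ∣ r ∧ ggcd b r s ^ b ∣ s :=
    Nat.sSup_mem (s := {k : ℕ | k ∣ r ∧ k ^ b ∣ s}) ⟨1, by simp⟩ hbdd
  refine ⟨fun h => ⟨h.trans hmem.1, (pow_dvd_pow_of_dvd h b).trans hmem.2⟩, fun h => ?_⟩
  have hlcm : (k.lcm (ggcd b r s)) ∣ r ∧ (k.lcm (ggcd b r s)) ^ b ∣ s :=
    ⟨Nat.lcm_dvd h.1 hmem.1, by
      rw [← Nat.pow_lcm_pow]
      exact Nat.lcm_dvd h.2 hmem.2⟩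
  have hle : k.lcm (ggcd b r s) ≤ ggcd b r s := le_csSup hbdd hlcm
  have heq := Nat.dvd_antisymm (Nat.dvd_lcm_right k (ggcd b r s)) <| by
    rw [le_antisymm hle (Nat.le_of_dvd (Nat.pos_of_dvd_of_pos hlcm.1 hr) (Nat.dvd_lcm_right _ _))]
  exact heq ▸ Nat.dvd_lcm_left k (ggcd b r s)

theorem sum_divisors_moebius (n : ℕ) :
    ∑ d ∈ n.divisors, (μ d : ℝ) = if n = 1 then 1 else 0 := by
  have h := congrArg (fun f : ArithmeticFunction ℤ => f n) ArithmeticFunction.moebius_mul_coe_zeta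
  simp only [ArithmeticFunction.coe_mul_zeta_apply, ArithmeticFunction.one_apply] at h
  exact_mod_cast h

theorem sum_moebius_dvd {b r s N : ℕ} (hr : 0 < r) (hrN : r ≤ N) :
    ∑ k ∈ Finset.Icc 1 N, (if k ∣ r ∧ k ^ b ∣ s then (μ k : ℝ) else 0) =
      if ggcd b r s = 1 then 1 else 0 := by
  have hdvd : ggcd b r s ∣ r := ((dvd_ggcd_iff hr _).1 dvd_rfl).1
  have hpos := Nat.pos_of_dvd_of_pos hdvd hr
  rw [← sum_divisors_moebius, ← Finset.sum_filter]
  refine Finset.sum_congr ?_ fun _ _ => rfl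
  ext k
  simp only [Finset.mem_filter, Finset.mem_Icc, Nat.mem_divisors, ← dvd_ggcd_iff hr]
  refine ⟨fun h => ⟨h.2, hpos.ne'⟩, fun h => ⟨⟨Nat.pos_of_dvd_of_pos h.1 hpos, ?_⟩, h.1⟩⟩
  exact (Nat.le_of_dvd hr (h.1.trans hdvd)).trans hrN

theorem card_filter_ggcd_eq_one (b N : ℕ) :
    (((Finset.Icc 1 N ×ˢ Finset.Icc 1 N).filter
      (fun p : ℕ × ℕ => ggcd b p.1 p.2 = 1)).card : ℝ) =
      ∑' k : ℕ, (μ k : ℝ) * ((N / k : ℕ) * (N / k ^ b : ℕ)) := by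
  have hcard (m : ℕ) : ((Finset.Icc 1 N).filter (m ∣ ·)).card = N / m :=
    Nat.Ioc_filter_dvd_card_eq_div N m
  rw [tsum_eq_sum (s := Finset.Icc 1 N) fun k hk => ?_]
  · rw [Finset.card_filter, Nat.cast_sum]
    calc
      _ = ∑ p ∈ Finset.Icc 1 N ×ˢ Finset.Icc 1 N, ∑ k ∈ Finset.Icc 1 N,
          (if k ∣ p.1 ∧ k ^ b ∣ p.2 then (μ k : ℝ) else 0) := by
        refine Finset.sum_congr rfl fun p hp => ?_
        simp only [Finset.mem_product, Finset.mem_Icc] at hp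
        rw [sum_moebius_dvd hp.1.1 hp.1.2]
        push_cast
        rfl
      _ = _ := by
        rw [Finset.sum_comm]
        refine Finset.sum_congr rfl fun k _ => ?_
        rw [← Finset.sum_filter, Finset.sum_const, Finset.filter_product, Finset.card_product,
          hcard, hcard, nsmul_eq_mul, Nat.cast_mul, mul_comm]
  · rcases Nat.eq_zero_or_pos k with rfl | hk0
    · simp
    · rw [Nat.div_eq_of_lt (by simpa [Nat.succ_le_iff, hk0] using hk)]
      simp

theorem tendsto_natCast_div_div_atTop (m : ℕ) :
    Tendsto (fun N : ℕ => ((N / m : ℕ) : ℝ) / N) atTop (nhds (1 / m)) := by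
  have h := (tendsto_nat_floor_mul_div_atTop (R := ℝ) (a := 1 / (m : ℝ)) (by positivity)).comp
    tendsto_natCast_atTop_atTop
  refine h.congr fun N => ?_
  simp only [Function.comp_apply, one_div_mul_eq_div, Nat.floor_div_natCast, Nat.floor_natCast]

theorem natCast_div_div_le (N m : ℕ) : ((N / m : ℕ) : ℝ) / N ≤ 1 / m := by
  rcases Nat.eq_zero_or_pos N with rfl | hN
  · simp
  · have hN' : (0 : ℝ) < N := by exact_mod_cast hN
    rw [div_le_iff₀ hN', one_div_mul_eq_div]
    exact Nat.cast_div_le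

theorem abs_moebius_cast_le_one (k : ℕ) : |(μ k : ℝ)| ≤ 1 := by
  exact_mod_cast ArithmeticFunction.abs_moebius_le_one (n := k)

theorem tsum_moebius_div_pow {m : ℕ} (hm : 1 < m) :
    ∑' k : ℕ, (μ k : ℝ) * (1 / (k : ℝ) ^ m) = 1 / ∑' n : ℕ, (1 : ℝ) / ((n : ℝ) + 1) ^ m := by
  have hs : 1 < (m : ℂ).re := by simpa using hm
  have h := ArithmeticFunction.LSeries_zeta_mul_Lseries_moebius hs
  rw [ArithmeticFunction.LSeries_zeta_eq_riemannZeta hs,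
    zeta_eq_tsum_one_div_nat_add_one_cpow hs] at h
  have hL : LSeries (fun n => ((μ n : ℤ) : ℂ)) m =
      ((∑' k : ℕ, (μ k : ℝ) * (1 / (k : ℝ) ^ m) : ℝ) : ℂ) := by
    rw [LSeries, Complex.ofReal_tsum]
    refine tsum_congr fun k => ?_
    rcases eq_or_ne k 0 with rfl | hk
    · simp
    · rw [LSeries.term_of_ne_zero hk, Complex.cpow_natCast]
      push_cast
      ring
  have hZ : ∑' n : ℕ, 1 / ((n : ℂ) + 1) ^ (m : ℂ) =
      ((∑' n : ℕ, (1 : ℝ) / ((n : ℝ) + 1) ^ m : ℝ) : ℂ) := by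
    rw [Complex.ofReal_tsum]
    refine tsum_congr fun n => ?_
    rw [Complex.cpow_natCast]
    push_cast
    rfl
  rw [hL, hZ] at h
  exact eq_one_div_of_mul_eq_one_right (by exact_mod_cast h)

/-- Fix `b ≥ 1`.  The proportion of points `(r, s)` with `1 ≤ r, s ≤ N` that
are `b`-visible (i.e. `ggcd b r s = 1`) tends to `1 / ζ(b + 1)` as `N → ∞`,
where `ζ(t) = ∑_{n ≥ 1} 1 / n ^ t`. -/
theorem density_b_visible_points (b : ℕ) (hb : 1 ≤ b) :
    Tendsto
      (fun N : ℕ =>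
        (((Finset.Icc 1 N ×ˢ Finset.Icc 1 N).filter
            (fun p : ℕ × ℕ => ggcd b p.1 p.2 = 1)).card : ℝ) / (N : ℝ) ^ 2)
      atTop (nhds (1 / ∑' n : ℕ, (1 : ℝ) / ((n : ℝ) + 1) ^ (b + 1))) := by
  have hterm (N k : ℕ) : (μ k : ℝ) * ((N / k : ℕ) * (N / k ^ b : ℕ)) / (N : ℝ) ^ 2 =
      μ k * (((N / k : ℕ) : ℝ) / N * (((N / k ^ b : ℕ) : ℝ) / N)) := by
    rw [div_mul_div_comm, mul_div_assoc, sq]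
  have hpow (k : ℕ) : (1 : ℝ) / (k : ℝ) ^ (b + 1) = 1 / (k : ℝ) * (1 / ((k ^ b : ℕ) : ℝ)) := by
    rw [one_div_mul_one_div, Nat.cast_pow, pow_succ']
  rw [← tsum_moebius_div_pow (by omega : 1 < b + 1)]
  simp_rw [card_filter_ggcd_eq_one, ← tsum_div_const, hterm]
  refine tendsto_tsum_of_dominated_convergence (bound := fun k : ℕ => 1 / (k : ℝ) ^ (b + 1))
    (Real.summable_one_div_nat_pow.2 (by omega)) (fun k => ?_) (Eventually.of_forall fun N k => ?_)
  · rw [hpow]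
    exact ((tendsto_natCast_div_div_atTop k).mul
      (tendsto_natCast_div_div_atTop (k ^ b))).const_mul _
  · rw [hpow, norm_mul, Real.norm_eq_abs, Real.norm_of_nonneg (by positivity)]
    refine (mul_le_of_le_one_left (by positivity) (abs_moebius_cast_le_one k)).trans ?_
    exact mul_le_mul (natCast_div_div_le N k) (natCast_div_div_le N (k ^ b)) (by positivity)
      (by positivity)
end

section
/- Let f(x) = (a/b)·x^n where a, n ∈ ℤ⁺, b = p₁^{j₁} p₂^{j₂} ⋯ p_r^{j_r} with p₁, …, p_r distinct primes, j₁, …, j_r ∈ ℤ⁺, and gcd(a, p₁ p₂ ⋯ p_r) = 1. Set t = ∏_{i=1}^{r} p_i^{⌈j_i / n⌉}. Then for a positive integer x, the value f(x) = a·x^n / b is an integer if and only if t divides x; in other words, every lattice point on the graph of f has the form (x, f(x)) with x ∈ t·ℤ. -/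
/-- A product of powers of distinct primes divides `m` iff each of the prime powers does. -/
theorem prod_prime_pow_dvd_iff {ι : Type*} [Fintype ι] {p : ι → ℕ} (hp : ∀ i, (p i).Prime)
    (hinj : Function.Injective p) (e : ι → ℕ) (m : ℕ) :
    ∏ i, p i ^ e i ∣ m ↔ ∀ i, p i ^ e i ∣ m := by
  refine ⟨fun h i => (Finset.dvd_prod_of_mem _ (Finset.mem_univ i)).trans h, fun h => ?_⟩
  refine Fintype.prod_dvd_of_isRelPrime (fun i k hik => ?_) h
  exact Nat.coprime_iff_isRelPrime.mp <|
    Nat.Coprime.pow _ _ ((Nat.coprime_primes (hp i) (hp k)).mpr (hinj.ne hik))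

/-- For a prime `q`, the power `q ^ k` divides `x ^ n` iff `q ^ ⌈k / n⌉` divides `x`. -/
theorem Nat.Prime.pow_dvd_pow_iff_pow_ceil_dvd {q n x : ℕ} (hq : q.Prime) (hn : 0 < n)
    (hx : x ≠ 0) (k : ℕ) :
    q ^ k ∣ x ^ n ↔ q ^ (⌈(k : ℚ) / (n : ℚ)⌉.toNat) ∣ x := by
  have hn' : (0 : ℚ) < n := by exact_mod_cast hn
  rw [hq.pow_dvd_iff_le_factorization (pow_ne_zero n hx), hq.pow_dvd_iff_le_factorization hx,
    Int.toNat_le, Int.ceil_le, div_le_iff₀ hn', Nat.factorization_pow, Finsupp.smul_apply,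
    smul_eq_mul, mul_comm n]
  norm_cast

/-- Let `f(x) = (a/b) x^n` with `a, n` positive integers,
`b = p 1 ^ j 1 ⋯ p r ^ j r` a product of powers of distinct primes with
positive exponents, and `a` coprime to `p 1 ⋯ p r`.  Set
`t = ∏ i, p i ^ ⌈j i / n⌉`.  Then for a positive integer `x`, the value
`f(x) = a x^n / b` is an integer (i.e. `b ∣ a * x ^ n`) if and only if
`t ∣ x`. -/
theorem lattice_points_on_power_curve (a n r : ℕ) (ha : 0 < a) (hn : 0 < n)
    (hr : 0 < r) (p : Fin r → ℕ) (j : Fin r → ℕ)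
    (hp : ∀ i, (p i).Prime) (hpdist : Function.Injective p)
    (hj : ∀ i, 0 < j i) (b : ℕ) (hb : b = ∏ i, p i ^ j i)
    (hcop : Nat.gcd a (∏ i, p i) = 1) (t : ℕ)
    (ht : t = ∏ i, p i ^ (⌈(j i : ℚ) / (n : ℚ)⌉.toNat)) :
    ∀ x : ℕ, 0 < x → (b ∣ a * x ^ n ↔ t ∣ x) := by
  intro x hx
  have hab : Nat.Coprime b a := by
    rw [hb]
    refine Nat.Coprime.prod_left fun i _ => Nat.Coprime.pow_left _ ?_
    exact (Nat.Coprime.coprime_dvd_right (Finset.dvd_prod_of_mem p (Finset.mem_univ i)) hcop).symm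
  rw [hab.dvd_mul_left, hb, ht, prod_prime_pow_dvd_iff hp hpdist, prod_prime_pow_dvd_iff hp hpdist]
  exact forall_congr' fun i => (hp i).pow_dvd_pow_iff_pow_ceil_dvd hn hx.ne' (j i)
end

section
/- Fix an integer s ≥ 2. The density of lattice points in ℤ^s visible from the origin is 1/ζ(s); precisely, the limit as N → ∞ of (1/N^s)·#{(x₁, …, x_s) : 1 ≤ x_i ≤ N for all i, gcd(x₁, …, x_s) = 1} equals 1/ζ(s), where ζ is the Riemann zeta function. -/
open Filter

open ArithmeticFunction in
theorem sum_Icc_moebius_ite_dvd {g N : ℕ} (hg : 0 < g) (hN : g ≤ N) :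
    ∑ d ∈ Finset.Icc 1 N, (if d ∣ g then (moebius d : ℝ) else 0) = if g = 1 then 1 else 0 := by
  have hdiv : (Finset.Icc 1 N).filter (· ∣ g) = g.divisors := by
    ext d
    simp only [Finset.mem_filter, Finset.mem_Icc, Nat.mem_divisors]
    constructor
    · rintro ⟨-, h⟩
      exact ⟨h, hg.ne'⟩
    · rintro ⟨h, -⟩
      exact ⟨⟨Nat.pos_of_dvd_of_pos h hg, (Nat.le_of_dvd hg h).trans hN⟩, h⟩
  rw [← Finset.sum_filter, hdiv]
  have h := congrArg (fun f : ArithmeticFunction ℝ => f g) (coe_zeta_mul_coe_moebius (R := ℝ))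
  simpa only [coe_zeta_mul_apply, intCoe_apply, one_apply] using h

theorem card_filter_piFinset_dvd (s N d : ℕ) :
    ((Fintype.piFinset fun _ : Fin s => Finset.Icc 1 N).filter
      (fun x : Fin s → ℕ => d ∣ Finset.univ.gcd x)).card = (N / d) ^ s := by
  have h : (Fintype.piFinset fun _ : Fin s => Finset.Icc 1 N).filter
      (fun x : Fin s → ℕ => d ∣ Finset.univ.gcd x) =
      Fintype.piFinset fun _ : Fin s => (Finset.Ioc 0 N).filter (d ∣ ·) := by
    ext x
    simp [Finset.dvd_gcd_iff, Fintype.mem_piFinset, forall_and, Nat.succ_le_iff,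
      Nat.pos_iff_ne_zero]
  rw [h, Fintype.card_piFinset_const, Nat.Ioc_filter_dvd_card_eq_div]

open ArithmeticFunction in
/-- Möbius inversion for the number of visible points in a cube. -/
theorem card_visible_eq_sum_moebius {s : ℕ} (hs : 0 < s) (N : ℕ) :
    (((Fintype.piFinset fun _ : Fin s => Finset.Icc 1 N).filter
      (fun x : Fin s → ℕ => Finset.univ.gcd x = 1)).card : ℝ) =
      ∑ d ∈ Finset.Icc 1 N, (moebius d : ℝ) * ((N / d : ℕ) : ℝ) ^ s := by
  have hgcd : ∀ x ∈ Fintype.piFinset fun _ : Fin s => Finset.Icc 1 N,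
      (if Finset.univ.gcd x = 1 then (1 : ℝ) else 0) =
        ∑ d ∈ Finset.Icc 1 N, if d ∣ Finset.univ.gcd x then (moebius d : ℝ) else 0 := by
    intro x hx
    have hx₀ := Finset.mem_Icc.mp (Fintype.mem_piFinset.mp hx ⟨0, hs⟩)
    have hdvd : Finset.univ.gcd x ∣ x ⟨0, hs⟩ := Finset.gcd_dvd (Finset.mem_univ _)
    exact (sum_Icc_moebius_ite_dvd (Nat.pos_of_dvd_of_pos hdvd hx₀.1)
      ((Nat.le_of_dvd hx₀.1 hdvd).trans hx₀.2)).symm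
  rw [← Finset.sum_boole, Finset.sum_congr rfl hgcd, Finset.sum_comm]
  refine Finset.sum_congr rfl fun d _ => ?_
  rw [← Finset.sum_filter, Finset.sum_const, card_filter_piFinset_dvd, nsmul_eq_mul, mul_comm]
  push_cast
  rfl

open ArithmeticFunction in
theorem tsum_moebius_div_pow_s18 {s : ℕ} (hs : 2 ≤ s) :
    ∑' d : ℕ, (moebius d : ℝ) / (d : ℝ) ^ s = 1 / ∑' n : ℕ, (1 : ℝ) / ((n : ℝ) + 1) ^ s := by
  have hre : 1 < (s : ℂ).re := by
    rw [Complex.natCast_re]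
    exact_mod_cast hs
  have hmul := LSeries_one_mul_Lseries_moebius hre
  have hone : LSeries 1 (s : ℂ) = ((∑' n : ℕ, (1 : ℝ) / ((n : ℝ) + 1) ^ s : ℝ) : ℂ) := by
    rw [LSeries_one_eq_riemannZeta hre, zeta_eq_tsum_one_div_nat_add_one_cpow hre]
    push_cast
    exact tsum_congr fun n => by rw [Complex.cpow_natCast]
  have hmoeb : LSeries (fun n => (moebius n : ℂ)) (s : ℂ) =
      ((∑' d : ℕ, (moebius d : ℝ) / (d : ℝ) ^ s : ℝ) : ℂ) := by
    push_cast
    refine tsum_congr fun n => ?_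
    rcases eq_or_ne n 0 with rfl | hn
    · simp
    · rw [LSeries.term_of_ne_zero hn, Complex.cpow_natCast]
  rw [hone, hmoeb, ← Complex.ofReal_mul, Complex.ofReal_eq_one] at hmul
  exact eq_one_div_of_mul_eq_one_right hmul

/-- Fix `s ≥ 2`.  The density of lattice points in `ℤ^s` visible from the
origin is `1 / ζ(s)`: the proportion of tuples `(x₁, …, x_s)` with
`1 ≤ xᵢ ≤ N` and `gcd (x₁, …, x_s) = 1` tends to `1 / ζ(s)` as `N → ∞`,
where `ζ(t) = ∑_{n ≥ 1} 1 / n ^ t`. -/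
theorem density_visible_points_higher_dim (s : ℕ) (hs : 2 ≤ s) :
    Tendsto
      (fun N : ℕ =>
        (((Fintype.piFinset fun _ : Fin s => Finset.Icc 1 N).filter
            (fun x : Fin s → ℕ => Finset.univ.gcd x = 1)).card : ℝ) /
          (N : ℝ) ^ s)
      atTop (nhds (1 / ∑' n : ℕ, (1 : ℝ) / ((n : ℝ) + 1) ^ s)) := by
  have hs₀ : s ≠ 0 := by omega
  have hsum (N : ℕ) :
      (((Fintype.piFinset fun _ : Fin s => Finset.Icc 1 N).filter
          (fun x : Fin s → ℕ => Finset.univ.gcd x = 1)).card : ℝ) / (N : ℝ) ^ s =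
        ∑' d : ℕ, (ArithmeticFunction.moebius d : ℝ) * (((N / d : ℕ) : ℝ) / N) ^ s := by
    rw [card_visible_eq_sum_moebius (by omega), tsum_eq_sum (s := Finset.Icc 1 N),
      Finset.sum_div]
    · exact Finset.sum_congr rfl fun d _ => by rw [div_pow, mul_div_assoc]
    · intro d hd
      rcases Nat.eq_zero_or_pos d with rfl | hd₀
      · simp
      · have : N < d := by
          simp only [Finset.mem_Icc, not_and, not_le] at hd
          exact hd hd₀
        simp [Nat.div_eq_of_lt this, hs₀]
  simp only [hsum]
  rw [← tsum_moebius_div_pow_s18 hs]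
  refine tendsto_tsum_of_dominated_convergence (bound := fun d : ℕ => 1 / (d : ℝ) ^ s)
    (Real.summable_one_div_nat_pow.mpr (by omega)) (fun d => ?_)
    (Eventually.of_forall fun N d => ?_)
  · have hlim : Tendsto (fun N : ℕ => ((N / d : ℕ) : ℝ) / N) atTop (nhds (1 / (d : ℝ))) := by
      have h := (tendsto_nat_floor_mul_div_atTop (R := ℝ) (a := 1 / (d : ℝ))
        (by positivity)).comp tendsto_natCast_atTop_atTop
      refine h.congr fun N => ?_
      simp only [Function.comp_apply]
      rw [one_div_mul_eq_div, Nat.floor_div_eq_div]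
    simpa [div_eq_mul_inv] using (hlim.pow s).const_mul (ArithmeticFunction.moebius d : ℝ)
  · have hmoeb : ‖(ArithmeticFunction.moebius d : ℝ)‖ ≤ 1 := by
      rw [Real.norm_eq_abs]
      exact_mod_cast ArithmeticFunction.abs_moebius_le_one (n := d)
    have hdiv : ((N / d : ℕ) : ℝ) / N ≤ 1 / d := by
      rcases Nat.eq_zero_or_pos N with rfl | hN
      · simp
      · rw [div_le_iff₀ (by positivity), one_div_mul_eq_div]
        exact Nat.cast_div_le
    rw [norm_mul, Real.norm_of_nonneg (by positivity : 0 ≤ (((N / d : ℕ) : ℝ) / N) ^ s),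
      ← one_div_pow]
    exact (mul_le_of_le_one_left (by positivity) hmoeb).trans (by gcongr)
end
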